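/- arXiv:2604.26391 — 3 statements merged into one kernel-verified Lean document; each statement's English description precedes it below -/
import Mathlib

section
/- Let e and s be integers with 1 ≤ e < s and let q be a prime power with q > e·binom(s,e). Then there exist row vectors h_1, …, h_s ∈ 𝔽_q^e such that h_1 + h_2 + ⋯ + h_s = 0 and every subset of {h_1, …, h_s} of cardinality at most e is linearly independent over 𝔽_q. -/
open Finset

open scoped Classical

noncomputable section

/-- Probability that the random variable `X` takes the value `s`, under the weights `μ`. -/
def prb {Ω : Type} [Fintype Ω] (μ : Ω → ℝ) {α : Type} (X : Ω → α) (s : α) : ℝ :=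
  ∑ ω ∈ Finset.univ.filter fun ω => X ω = s, μ ω

/-- Shannon entropy of `X` in `q`-ary units. -/
def ent (q : ℕ) {Ω : Type} [Fintype Ω] (μ : Ω → ℝ) {α : Type} [Fintype α] (X : Ω → α) : ℝ :=
  -∑ s : α, prb μ X s * Real.logb q (prb μ X s)

/-- Conditional entropy `H(X | Y)` in `q`-ary units. -/
def condEnt (q : ℕ) {Ω : Type} [Fintype Ω] (μ : Ω → ℝ) {α β : Type} [Fintype α] [Fintype β]
    (X : Ω → α) (Y : Ω → β) : ℝ :=
  ent q μ (fun ω => (X ω, Y ω)) - ent q μ Y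

/-- Conditional mutual information `I(X ; Y ∣ Z)` in `q`-ary units. -/
def mutInfo (q : ℕ) {Ω : Type} [Fintype Ω] (μ : Ω → ℝ) {α β γ : Type}
    [Fintype α] [Fintype β] [Fintype γ] (X : Ω → α) (Y : Ω → β) (Z : Ω → γ) : ℝ :=
  condEnt q μ X Z - condEnt q μ X fun ω => (Y ω, Z ω)

/-- The joint random variable formed by the members of a family of random variables
indexed by a finset. -/
def restr {Ω ι α : Type} (Z : ι → Ω → α) (T : Finset ι) : Ω → { i // i ∈ T } → α :=
  fun ω i => Z i.1 ω

/-- The set of users `𝒦`: user `⟨u,v⟩` is the `v`-th user of server `u`. -/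
abbrev Usr (U : ℕ) (V : Fin U → ℕ) : Type := Σ u : Fin U, Fin (V u)

/-- Total number of users, `K = ∑ u, V u`. -/
def Ktot (U : ℕ) (V : Fin U → ℕ) : ℕ := ∑ u, V u

/-- The users connected to server `u`, `𝒦_{{u}}`. -/
def Ksrv (U : ℕ) (V : Fin U → ℕ) (u : Fin U) : Finset (Usr U V) :=
  Finset.univ.filter fun i => i.1 = u

/-- The users connected to a set of servers, `𝒦_𝒰`. -/
def KsrvSet (U : ℕ) (V : Fin U → ℕ) (A : Finset (Fin U)) : Finset (Usr U V) :=
  Finset.univ.filter fun i => i.1 ∈ A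

/-- The set of servers `𝒰^{(m,n)}` associated with a security input set `Sm` and a
colluding set `Tn`. -/
def UServers (U : ℕ) (V : Fin U → ℕ) (Sm Tn : Finset (Usr U V)) : Finset (Fin U) :=
  Finset.univ.filter fun u =>
    (Sm ∩ Ksrv U V u).Nonempty ∧ ((Sm ∪ Tn) ∩ Ksrv U V u).card = V u

/-- The set `(𝒮_m ∩ 𝒦_{{u}}) ∪ 𝒦_{𝒰^{(m,n)}} ∪ 𝒯_n`. -/
def BigB (U : ℕ) (V : Fin U → ℕ) (Sm Tn : Finset (Usr U V)) (u : Fin U) : Finset (Usr U V) :=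
  (Sm ∩ Ksrv U V u) ∪ KsrvSet U V (UServers U V Sm Tn) ∪ Tn

/-- The implicit security input set `𝒮_I`. -/
def SImp (U : ℕ) (V : Fin U → ℕ) {M N : ℕ} (S : Fin M → Finset (Usr U V))
    (T : Fin N → Finset (Usr U V)) : Finset (Usr U V) :=
  Finset.univ.filter fun i =>
    (∀ m, i ∉ S m) ∧
    ∃ u m n, (BigB U V (S m) (T n) u).card = Ktot U V - 1 ∧ i ∉ BigB U V (S m) (T n) u

/-- The total security input set `𝒮̄`. -/
def Sbar (U : ℕ) (V : Fin U → ℕ) {M N : ℕ} (S : Fin M → Finset (Usr U V))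
    (T : Fin N → Finset (Usr U V)) : Finset (Usr U V) :=
  (Finset.univ.biUnion fun m => S m) ∪ SImp U V S T

/-- The set `𝒜_{u,m,n}`. -/
def Aset (U : ℕ) (V : Fin U → ℕ) {M N : ℕ} (S : Fin M → Finset (Usr U V))
    (T : Fin N → Finset (Usr U V)) (u : Fin U) (m : Fin M) (n : Fin N) : Finset (Usr U V) :=
  BigB U V (S m) (T n) u ∩ Sbar U V S T

/-- `a* = max_{u,m,n} |𝒜_{u,m,n}|`. -/
def aStar (U : ℕ) (V : Fin U → ℕ) {M N : ℕ} (S : Fin M → Finset (Usr U V))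
    (T : Fin N → Finset (Usr U V)) : ℕ :=
  Finset.univ.sup fun t : Fin U × Fin M × Fin N => (Aset U V S T t.1 t.2.1 t.2.2).card

/-- `|((𝒮_m ∩ 𝒦_{{u}}) ∪ 𝒯_n) ∩ 𝒮̄| + |𝒰^{(m,n)} ∖ {u}|`. -/
def eVal (U : ℕ) (V : Fin U → ℕ) {M N : ℕ} (S : Fin M → Finset (Usr U V))
    (T : Fin N → Finset (Usr U V)) (u : Fin U) (m : Fin M) (n : Fin N) : ℕ :=
  (((S m ∩ Ksrv U V u) ∪ T n) ∩ Sbar U V S T).card + ((UServers U V (S m) (T n)).erase u).card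

/-- `e* = max_{u,m,n} (|((𝒮_m ∩ 𝒦_{{u}}) ∪ 𝒯_n) ∩ 𝒮̄| + |𝒰^{(m,n)} ∖ {u}|)`. -/
def eStar (U : ℕ) (V : Fin U → ℕ) {M N : ℕ} (S : Fin M → Finset (Usr U V))
    (T : Fin N → Finset (Usr U V)) : ℕ :=
  Finset.univ.sup fun t : Fin U × Fin M × Fin N => eVal U V S T t.1 t.2.1 t.2.2

/-- The set `𝒬_1`. -/
def Q1set (U : ℕ) (V : Fin U → ℕ) {M N : ℕ} (S : Fin M → Finset (Usr U V))
    (T : Fin N → Finset (Usr U V)) : Finset (Usr U V) :=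
  (Finset.univ.filter fun t : Fin U × Fin M × Fin N =>
      (Aset U V S T t.1 t.2.1 t.2.2).card = (Sbar U V S T).card).biUnion
    fun t => BigB U V (S t.2.1) (T t.2.2) t.1

/-- The set `𝒬_2`. -/
def Q2set (U : ℕ) (V : Fin U → ℕ) {M N : ℕ} (S : Fin M → Finset (Usr U V))
    (T : Fin N → Finset (Usr U V)) : Finset (Usr U V) :=
  (Finset.univ.filter fun t : Fin U × Fin M × Fin N =>
      eVal U V S T t.1 t.2.1 t.2.2 = eStar U V S T).biUnion
    fun t => BigB U V (S t.2.1) (T t.2.2) t.1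

/-- The set `𝒬`. -/
def Qset (U : ℕ) (V : Fin U → ℕ) {M N : ℕ} (S : Fin M → Finset (Usr U V))
    (T : Fin N → Finset (Usr U V)) : Finset (Usr U V) :=
  if (Q1set U V S T).Nonempty then Q1set U V S T ∪ Q2set U V S T else ∅

/-- A secure-aggregation scheme: all structural, distributional, correctness and
security constraints of the multi-server secure aggregation model, with entropies in
`q`-ary units for `q = |F|`. -/
def IsScheme (U : ℕ) (V : Fin U → ℕ) (M N : ℕ) (S : Fin M → Finset (Usr U V))
    (T : Fin N → Finset (Usr U V)) (F : Type) [Field F] [Fintype F]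
    (Ω : Type) [Fintype Ω] (μ : Ω → ℝ) (L LX LY LZ LSig : ℕ)
    (W : Usr U V → Ω → Fin L → F) (Z : Usr U V → Ω → Fin LZ → F)
    (X : Usr U V → Ω → Fin LX → F) (Y : Fin U → Ω → Fin LY → F)
    (ZS : Ω → Fin LSig → F) : Prop :=
  let q := Fintype.card F
  (1 ≤ L) ∧
  (∀ ω, 0 ≤ μ ω) ∧ (∑ ω, μ ω = 1) ∧
  -- each input consists of `L` i.i.d. uniform `q`-ary symbols
  (∀ i, ent q μ (W i) = L) ∧
  -- the inputs are mutually independent of each other and of all keys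
  (ent q μ (fun ω => (restr W Finset.univ ω, restr Z Finset.univ ω)) =
    ent q μ (restr Z Finset.univ) + ∑ i, ent q μ (W i)) ∧
  -- the source key consists of `LSig` i.i.d. uniform `q`-ary symbols
  (ent q μ ZS = LSig) ∧
  -- the individual keys are deterministic functions of the source key
  (condEnt q μ (restr Z Finset.univ) ZS = 0) ∧
  -- each user message is a deterministic function of its input and key
  (∀ i, condEnt q μ (X i) (fun ω => (W i ω, Z i ω)) = 0) ∧
  -- each server message is a deterministic function of its received messages
  (∀ u, condEnt q μ (Y u) (restr X (Ksrv U V u)) = 0) ∧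
  -- correctness
  (∀ k, condEnt q μ (fun ω => ∑ i, W i ω)
    (fun ω => (restr Y (Finset.univ.erase k) ω, restr X (Ksrv U V k) ω)) = 0) ∧
  -- security
  (∀ k m n, mutInfo q μ
    (fun ω => (restr Y (Finset.univ.erase k) ω, restr X (Ksrv U V k) ω))
    (restr W (S m))
    (fun ω => (∑ i, W i ω, restr W (T n) ω, restr Z (T n) ω)) = 0)

/-- A rate tuple `(R_X, R_Y, R_{Z_Σ})` is achievable. -/
def Achievable (U : ℕ) (V : Fin U → ℕ) (M N : ℕ) (S : Fin M → Finset (Usr U V))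
    (T : Fin N → Finset (Usr U V)) (R : ℝ × ℝ × ℝ) : Prop :=
  ∃ (F : Type) (iF : Field F) (iFt : Fintype F) (Ω : Type) (iΩ : Fintype Ω)
    (μ : Ω → ℝ) (L LX LY LZ LSig : ℕ)
    (W : Usr U V → Ω → Fin L → F) (Z : Usr U V → Ω → Fin LZ → F)
    (X : Usr U V → Ω → Fin LX → F) (Y : Fin U → Ω → Fin LY → F)
    (ZS : Ω → Fin LSig → F),
    R.1 = (LX : ℝ) / (L : ℝ) ∧ R.2.1 = (LY : ℝ) / (L : ℝ) ∧ R.2.2 = (LSig : ℝ) / (L : ℝ) ∧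
    @IsScheme U V M N S T F iF iFt Ω iΩ μ L LX LY LZ LSig W Z X Y ZS

end

theorem sum_eval_mul_eq_zero_of_sum_mul_pow_eq_zero {F ι : Type*} [CommRing F] {e : ℕ}
    (A : Finset ι) (v g : ι → F) (hg : ∀ k < e, ∑ i ∈ A, g i * v i ^ k = 0)
    {P : Polynomial F} (hP : P.degree < e) : ∑ i ∈ A, g i * P.eval (v i) = 0 := by
  have hev (i : ι) : P.eval (v i) = ∑ k ∈ Finset.range e, P.coeff k * v i ^ k := by
    rcases eq_or_ne P 0 with rfl | h0
    · simp
    · exact Polynomial.eval_eq_sum_range' ((Polynomial.natDegree_lt_iff_degree_lt h0).2 hP) _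
  simp_rw [hev, Finset.mul_sum]
  rw [Finset.sum_comm]
  refine Finset.sum_eq_zero fun k hk => ?_
  simp_rw [mul_left_comm (g _), ← Finset.mul_sum]
  rw [hg k (Finset.mem_range.1 hk), mul_zero]

theorem linearIndependent_pow_of_card_le {F ι : Type*} [Field F] [Fintype ι] {e : ℕ} {v : ι → F}
    (hv : Function.Injective v) (hι : Fintype.card ι ≤ e) :
    LinearIndependent F (fun (i : ι) (k : Fin e) => v i ^ (k : ℕ)) := by
  rw [Fintype.linearIndependent_iff]
  intro g hg j
  have hinj : Set.InjOn v (Finset.univ : Finset ι) := hv.injOn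
  have hpow : ∀ k < e, ∑ i, g i * v i ^ k = 0 := fun k hk => by
    simpa using congrFun hg ⟨k, hk⟩
  have hdeg : (Lagrange.basis Finset.univ v j).degree < e := by
    rw [Lagrange.degree_basis hinj (Finset.mem_univ j), Finset.card_univ]
    have : 0 < Fintype.card ι := Fintype.card_pos_iff.2 ⟨j⟩
    exact_mod_cast (by omega : Fintype.card ι - 1 < e)
  have h := sum_eval_mul_eq_zero_of_sum_mul_pow_eq_zero Finset.univ _ g hpow hdeg
  rw [Finset.sum_eq_single j] at h
  · rwa [Lagrange.eval_basis_self hinj (Finset.mem_univ j), mul_one] at h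
  · intro i _ hij
    rw [Lagrange.eval_basis_of_ne hij.symm (Finset.mem_univ i), mul_zero]
  · simp

/-- The Lagrange weights annihilate all powers of degree less than the number of nodes
minus one. -/
theorem sum_nodalWeight_mul_pow_eq_zero {F ι : Type*} [Field F] [DecidableEq ι]
    {A : Finset ι} {v : ι → F} (hv : Set.InjOn v A) {k : ℕ} (hk : k + 1 < A.card) :
    ∑ i ∈ A, Lagrange.nodalWeight A v i * v i ^ k = 0 := by
  have h := Lagrange.coeff_eq_sum hv (P := Polynomial.X ^ k)
    (by rw [Polynomial.degree_X_pow]; exact_mod_cast (by omega : k < A.card))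
  rw [Polynomial.coeff_X_pow, if_neg (by omega)] at h
  rw [h]
  refine Finset.sum_congr rfl fun i _ => ?_
  simp [Lagrange.nodalWeight, div_eq_mul_inv, mul_comm]

theorem le_mul_choose {e s : ℕ} (he : 1 ≤ e) (hes : e ≤ s) : s ≤ e * s.choose e := by
  obtain ⟨k, rfl⟩ := Nat.exists_eq_add_of_le' he
  obtain ⟨n, rfl⟩ := Nat.exists_eq_add_of_le' (he.trans hes)
  rw [mul_comm, ← Nat.add_one_mul_choose_eq]
  exact Nat.le_mul_of_pos_right _ (Nat.choose_pos (by omega))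

theorem stmt16_generic_vectors (e s q : ℕ) (he : 1 ≤ e) (hes : e < s)
    (F : Type) [Field F] [Fintype F] (hF : Fintype.card F = q)
    (hq : e * Nat.choose s e < q) :
    ∃ h : Fin s → Fin e → F,
      (∑ i, h i) = 0 ∧
      ∀ A : Finset (Fin s), A.card ≤ e →
        LinearIndependent F (fun i : { x // x ∈ A } => h i.1) := by
  obtain ⟨v⟩ : Nonempty (Fin s ↪ F) := Function.Embedding.nonempty_of_card_le (by
    rw [Fintype.card_fin, hF]
    exact (le_mul_choose he hes.le).trans hq.le)
  have hv : Set.InjOn v (Finset.univ : Finset (Fin s)) := v.injective.injOn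
  refine ⟨fun i k => Lagrange.nodalWeight Finset.univ v i * v i ^ (k : ℕ), ?_, fun A hA => ?_⟩
  · ext k
    rw [Finset.sum_apply]
    exact sum_nodalWeight_mul_pow_eq_zero hv (k := k) (by rw [Finset.card_fin]; omega)
  · exact (linearIndependent_pow_of_card_le
      (v.injective.comp Subtype.val_injective) (by rwa [Fintype.card_coe])).units_smul
      fun i => Units.mk0 _ (Lagrange.nodalWeight_ne_zero hv (Finset.mem_univ i.1))
end

section
/- In the multi-server secure aggregation model with heterogeneous security constraints, if e* = K, then the rate tuple (R_X, R_Y, R_{Z_Σ}) = (1, 1, K−1) is achievable; that is, there exist a field size q, block length L, and random variables (Z_Σ, {Z_{u,v}}, {X_{u,v}}, {Y_u}) with L_X = L_Y = L and L_Σ = (K−1)L satisfying the structural, correctness and security constraints. -/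
open Finset

open scoped Classical

/-- Shannon entropy as the expected surprisal over the sample space. -/
theorem ent_eq_sum_fiber (q : ℕ) {Ω α : Type} [Fintype Ω] [Fintype α] (μ : Ω → ℝ) (X : Ω → α) :
    ent q μ X =
      -∑ ω, μ ω * Real.logb q (∑ ω' ∈ Finset.univ.filter fun ω' => X ω' = X ω, μ ω') := by
  unfold ent
  rw [← Finset.sum_fiberwise Finset.univ X]
  congr 1
  refine Finset.sum_congr rfl fun s _ => ?_
  rw [prb, Finset.sum_mul]
  refine Finset.sum_congr rfl fun ω hω => ?_
  rw [(Finset.mem_filter.mp hω).2]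

/-- Entropy depends only on the partition of the sample space induced by the variable. -/
theorem ent_congr (q : ℕ) {Ω α β : Type} [Fintype Ω] [Fintype α] [Fintype β] (μ : Ω → ℝ)
    {X : Ω → α} {Y : Ω → β} (h : ∀ ω ω', X ω = X ω' ↔ Y ω = Y ω') :
    ent q μ X = ent q μ Y := by
  simp only [ent_eq_sum_fiber, h]

/-- A variable determined by `Y` has zero conditional entropy given `Y`. -/
theorem condEnt_eq_zero (q : ℕ) {Ω α β : Type} [Fintype Ω] [Fintype α] [Fintype β] (μ : Ω → ℝ)
    {X : Ω → α} {Y : Ω → β} (h : ∀ ω ω', Y ω = Y ω' → X ω = X ω') :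
    condEnt q μ X Y = 0 := by
  refine sub_eq_zero.mpr (ent_congr q μ fun ω ω' => ?_)
  rw [Prod.mk.injEq]
  exact ⟨And.right, fun hY => ⟨h ω ω' hY, hY⟩⟩

theorem IsLinearMap.eq_iff_sub_mem_ker {F Ω α : Type} [Field F] [AddCommGroup Ω] [Module F Ω]
    [AddCommGroup α] [Module F α] {X : Ω → α} (hX : IsLinearMap F X) (ω ω' : Ω) :
    X ω = X ω' ↔ ω - ω' ∈ LinearMap.ker hX.mk' := by
  rw [LinearMap.mem_ker, IsLinearMap.mk'_apply, hX.map_sub, sub_eq_zero]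

/-- The uniform weights on a finite type. -/
noncomputable def unif (Ω : Type) [Fintype Ω] : Ω → ℝ := fun _ => (Fintype.card Ω : ℝ)⁻¹

section Linear

variable {F : Type} [Field F] [Fintype F] {Ω : Type} [Fintype Ω] [AddCommGroup Ω] [Module F Ω]

/-- Entropy, under the uniform distribution, of a variable whose fibres are the cosets of `P`. -/
theorem ent_unif_eq_finrank {α : Type} [Fintype α] {X : Ω → α} (P : Submodule F Ω)
    (h : ∀ ω ω', X ω = X ω' ↔ ω - ω' ∈ P) :
    ent (Fintype.card F) (unif Ω) X = Module.finrank F Ω - Module.finrank F P := by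
  have hq : (1 : ℝ) < Fintype.card F := by exact_mod_cast Fintype.one_lt_card
  have hfib : ∀ ω, (Finset.univ.filter fun ω' => X ω' = X ω).card = Fintype.card P := by
    intro ω
    rw [← Fintype.card_subtype]
    refine Fintype.card_congr ⟨fun a => ⟨a.1 - ω, (h _ _).mp a.2⟩,
      fun p => ⟨p.1 + ω, (h _ _).mpr (by simp)⟩, fun a => by simp, fun p => by simp⟩
  have hΩ : (Fintype.card Ω : ℝ) ≠ 0 := by simp
  rw [ent_eq_sum_fiber]
  simp only [unif, Finset.sum_const, hfib, nsmul_eq_mul, Finset.card_univ]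
  rw [mul_inv_cancel_left₀ hΩ, Module.card_eq_pow_finrank (K := F) (V := Ω),
    Module.card_eq_pow_finrank (K := F) (V := P)]
  have hq0 : (Fintype.card F : ℝ) ≠ 0 := by positivity
  push_cast
  rw [Real.logb_mul (by positivity) (by positivity), Real.logb_inv, Real.logb_pow, Real.logb_pow,
    Real.logb_self_eq_one hq]
  ring

/-- A surjective linear image of a uniform variable is uniform. -/
theorem ent_unif_of_surjective {α : Type} [Fintype α] [AddCommGroup α] [Module F α] {X : Ω → α}
    (hX : IsLinearMap F X) (hs : Function.Surjective X) :
    ent (Fintype.card F) (unif Ω) X = Module.finrank F α := by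
  rw [ent_unif_eq_finrank _ hX.eq_iff_sub_mem_ker, sub_eq_iff_eq_add]
  have h := LinearMap.finrank_range_add_finrank_ker hX.mk'
  rw [LinearMap.range_eq_top.mpr hs, finrank_top] at h
  exact_mod_cast h.symm

/-- Linear functions `A`, `B` of a uniform variable are conditionally independent given a linear
function `C` when the kernel of `C` is spanned by its intersections with the other two kernels. -/
theorem mutInfo_unif_eq_zero {α β γ : Type} [Fintype α] [Fintype β] [Fintype γ]
    [AddCommGroup α] [Module F α] [AddCommGroup β] [Module F β] [AddCommGroup γ] [Module F γ]
    {A : Ω → α} {B : Ω → β} {C : Ω → γ}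
    (hA : IsLinearMap F A) (hB : IsLinearMap F B) (hC : IsLinearMap F C)
    (h : ∀ ω, C ω = 0 → ∃ a b, ω = a + b ∧ A a = 0 ∧ C a = 0 ∧ B b = 0 ∧ C b = 0) :
    mutInfo (Fintype.card F) (unif Ω) A B C = 0 := by
  set PA := LinearMap.ker hA.mk'
  set PB := LinearMap.ker hB.mk'
  set PC := LinearMap.ker hC.mk'
  have hAC := ent_unif_eq_finrank (X := fun ω => (A ω, C ω)) (PA ⊓ PC) fun ω ω' => by
    rw [Prod.mk.injEq, hA.eq_iff_sub_mem_ker, hC.eq_iff_sub_mem_ker, Submodule.mem_inf]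
  have hBC := ent_unif_eq_finrank (X := fun ω => (B ω, C ω)) (PB ⊓ PC) fun ω ω' => by
    rw [Prod.mk.injEq, hB.eq_iff_sub_mem_ker, hC.eq_iff_sub_mem_ker, Submodule.mem_inf]
  have hABC := ent_unif_eq_finrank (X := fun ω => (A ω, (B ω, C ω)))
    ((PA ⊓ PC) ⊓ (PB ⊓ PC)) fun ω ω' => by
      rw [Prod.mk.injEq, Prod.mk.injEq, hA.eq_iff_sub_mem_ker, hB.eq_iff_sub_mem_ker,
        hC.eq_iff_sub_mem_ker, Submodule.mem_inf, Submodule.mem_inf, Submodule.mem_inf]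
      tauto
  have hsup : (PA ⊓ PC) ⊔ (PB ⊓ PC) = PC := by
    refine le_antisymm (sup_le inf_le_right inf_le_right) fun ω hω => ?_
    obtain ⟨a, b, rfl, hAa, hCa, hBb, hCb⟩ := h ω hω
    exact Submodule.add_mem_sup ⟨hAa, hCa⟩ ⟨hBb, hCb⟩
  have hdim := Submodule.finrank_sup_add_finrank_inf_eq (PA ⊓ PC) (PB ⊓ PC)
  rw [hsup] at hdim
  have hdim' : (Module.finrank F PC + Module.finrank F ((PA ⊓ PC) ⊓ (PB ⊓ PC) : Submodule F Ω) : ℝ)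
      = Module.finrank F (PA ⊓ PC : Submodule F Ω) + Module.finrank F (PB ⊓ PC : Submodule F Ω) := by
    exact_mod_cast hdim
  rw [mutInfo, condEnt, condEnt, hAC, hBC, hABC, ent_unif_eq_finrank PC hC.eq_iff_sub_mem_ker]
  linarith

end Linear

/-- The vectors of keys, one per user, that sum to zero. -/
abbrev ZeroSum (F ι : Type) [Field F] [Fintype ι] : Submodule F (ι → F) :=
  LinearMap.ker (∑ i, LinearMap.proj i : (ι → F) →ₗ[F] F)

theorem mem_zeroSum {F ι : Type} [Field F] [Fintype ι] {z : ι → F} :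
    z ∈ ZeroSum F ι ↔ ∑ i, z i = 0 := by
  simp [LinearMap.mem_ker]

theorem finrank_zeroSum (F ι : Type) [Field F] [Fintype ι] [Nonempty ι] :
    Module.finrank F (ZeroSum F ι) = Fintype.card ι - 1 := by
  have hs : Function.Surjective (∑ i, LinearMap.proj i : (ι → F) →ₗ[F] F) := fun c =>
    ⟨Pi.single (Classical.arbitrary ι) c, by simp⟩
  have h := LinearMap.finrank_range_add_finrank_ker (∑ i, LinearMap.proj i : (ι → F) →ₗ[F] F)
  rw [LinearMap.range_eq_top.mpr hs, finrank_top, Module.finrank_self,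
    Module.finrank_fintype_fun_eq_card] at h
  exact (Nat.sub_eq_of_eq_add' h.symm).symm

theorem card_usr (U : ℕ) (V : Fin U → ℕ) : Fintype.card (Usr U V) = Ktot U V := by
  simp [Ktot]

theorem sum_servers {G : Type} [AddCommMonoid G] (U : ℕ) (V : Fin U → ℕ) (f : Usr U V → G) :
    ∑ u, ∑ i ∈ Ksrv U V u, f i = ∑ i, f i :=
  Finset.sum_fiberwise Finset.univ (fun i : Usr U V => i.1) f

theorem restr_eq_iff {Ω ι α : Type} (Z : ι → Ω → α) (T : Finset ι) (ω ω' : Ω) :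
    restr Z T ω = restr Z T ω' ↔ ∀ i ∈ T, Z i ω = Z i ω' := by
  simp [funext_iff, restr]

theorem isLinearMap_restr {F Ω ι α : Type} [Field F] [AddCommGroup Ω] [Module F Ω]
    [AddCommGroup α] [Module F α] {Z : ι → Ω → α} (hZ : ∀ i, IsLinearMap F (Z i))
    (T : Finset ι) : IsLinearMap F (restr Z T) :=
  ⟨fun a b => funext fun i => (hZ i).map_add a b, fun c a => funext fun i => (hZ i).map_smul c a⟩

theorem IsLinearMap.prodMk {F Ω α β : Type} [Field F] [AddCommGroup Ω] [Module F Ω]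
    [AddCommGroup α] [Module F α] [AddCommGroup β] [Module F β] {f : Ω → α} {g : Ω → β}
    (hf : IsLinearMap F f) (hg : IsLinearMap F g) : IsLinearMap F fun ω => (f ω, g ω) :=
  ⟨fun a b => Prod.ext (hf.map_add a b) (hg.map_add a b),
    fun c a => Prod.ext (hf.map_smul c a) (hg.map_smul c a)⟩

theorem IsLinearMap.finsetSum {F Ω ι α : Type} [Field F] [AddCommGroup Ω] [Module F Ω]
    [AddCommGroup α] [Module F α] {f : ι → Ω → α} (hf : ∀ i, IsLinearMap F (f i))
    (T : Finset ι) : IsLinearMap F fun ω => ∑ i ∈ T, f i ω :=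
  ⟨fun a b => by simp only [(hf _).map_add, Finset.sum_add_distrib],
    fun c a => by simp only [(hf _).map_smul, Finset.smul_sum]⟩

section ZeroSumScheme

variable (F ι : Type) [Field F] [Fintype ι]

/-- Sample space of the zero-sum scheme: all inputs together with a zero-sum vector of keys. -/
abbrev Sample : Type := (ι → F) × ZeroSum F ι

variable {F ι}

/-- Input of user `i`. -/
def inputVar (i : ι) (ω : Sample F ι) : Fin 1 → F := fun _ => ω.1 i

/-- Key of user `i`. -/
def keyVar (i : ι) (ω : Sample F ι) : Fin 1 → F := fun _ => ω.2.1 i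

/-- Message of user `i`: its input masked by its key. -/
def msgVar (i : ι) (ω : Sample F ι) : Fin 1 → F := inputVar i ω + keyVar i ω

theorem isLinearMap_inputVar (i : ι) : IsLinearMap F (inputVar (F := F) i) :=
  ⟨fun _ _ => rfl, fun _ _ => rfl⟩

theorem isLinearMap_keyVar (i : ι) : IsLinearMap F (keyVar (F := F) i) :=
  ⟨fun _ _ => rfl, fun _ _ => rfl⟩

theorem isLinearMap_msgVar (i : ι) : IsLinearMap F (msgVar (F := F) i) :=
  ⟨fun a b => by
    simp only [msgVar, (isLinearMap_inputVar i).map_add, (isLinearMap_keyVar i).map_add]; abel,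
  fun c a => by
    simp only [msgVar, (isLinearMap_inputVar i).map_smul, (isLinearMap_keyVar i).map_smul,
      smul_add]⟩

theorem sum_keyVar (ω : Sample F ι) : ∑ i, keyVar i ω = 0 := by
  funext j
  simpa [keyVar] using mem_zeroSum.mp ω.2.2

theorem sum_msgVar (ω : Sample F ι) : ∑ i, msgVar i ω = ∑ i, inputVar i ω := by
  simp only [msgVar, Finset.sum_add_distrib, sum_keyVar, add_zero]

/-- A sample on which the inputs of `T` and their keys vanish, and the inputs sum to zero, splits
into one with no messages and one with no inputs. -/
theorem exists_split_sample (T : Finset ι) (ω : Sample F ι) (hsum : ∑ i, inputVar i ω = 0)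
    (hW : ∀ i ∈ T, inputVar i ω = 0) (hZ : ∀ i ∈ T, keyVar i ω = 0) :
    ∃ a b : Sample F ι, ω = a + b ∧ (∀ i, msgVar i a = 0) ∧ (∀ i, inputVar i b = 0) ∧
      (∑ i, inputVar i a = 0) ∧ (∀ i ∈ T, inputVar i a = 0) ∧ (∀ i ∈ T, keyVar i a = 0) ∧
      ∀ i ∈ T, keyVar i b = 0 := by
  have hmem : ω.1 ∈ ZeroSum F ι :=
    mem_zeroSum.mpr (by simpa [inputVar] using congrFun hsum 0)
  have hW' : ∀ i ∈ T, ω.1 i = 0 := fun i hi => congrFun (hW i hi) 0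
  have hZ' : ∀ i ∈ T, ω.2.1 i = 0 := fun i hi => congrFun (hZ i hi) 0
  refine ⟨(ω.1, -⟨ω.1, hmem⟩), (0, ω.2 + ⟨ω.1, hmem⟩), ?_, ?_, fun _ => rfl, hsum, hW, ?_, ?_⟩
  · ext <;> simp
  · intro i
    funext j
    simp [msgVar, inputVar, keyVar]
  · intro i hi
    funext j
    simp [keyVar, hW' i hi]
  · intro i hi
    funext j
    simp [keyVar, hW' i hi, hZ' i hi]

end ZeroSumScheme

/-- Masking the inputs with uniform keys that sum to zero gives a scheme, for any security
constraints. -/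
theorem isScheme_zeroSum (U : ℕ) (V : Fin U → ℕ) [Nonempty (Usr U V)] {M N : ℕ}
    (S : Fin M → Finset (Usr U V)) (T : Fin N → Finset (Usr U V)) (F : Type) [Field F] [Fintype F]
    [Fintype (Sample F (Usr U V))]
    (e : ZeroSum F (Usr U V) ≃ₗ[F] (Fin ((Ktot U V - 1) * 1) → F)) :
    IsScheme U V M N S T F (Sample F (Usr U V)) (unif _) 1 1 1 1 ((Ktot U V - 1) * 1)
      inputVar keyVar msgVar (fun u ω => ∑ i ∈ Ksrv U V u, msgVar i ω) (fun ω => e ω.2) := by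
  have hN : (Fintype.card (Sample F (Usr U V)) : ℝ) ≠ 0 := by simp
  have hW : ∀ i, ent (Fintype.card F) (unif (Sample F (Usr U V))) (inputVar i) = (1 : ℕ) := by
    intro i
    have hs : Function.Surjective (inputVar (F := F) i) := fun c =>
      ⟨(fun _ => c 0, 0), funext fun j => by rw [Subsingleton.elim j 0]; rfl⟩
    rw [ent_unif_of_surjective (isLinearMap_inputVar i) hs]
    simp
  have hZS : ent (Fintype.card F) (unif (Sample F (Usr U V))) (fun ω => e ω.2) =
      ((Ktot U V - 1) * 1 : ℕ) := by
    have hlin : IsLinearMap F fun ω : Sample F (Usr U V) => e ω.2 :=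
      (e.toLinearMap ∘ₗ LinearMap.snd F _ _).isLinear
    rw [ent_unif_of_surjective hlin fun c => ⟨(0, e.symm c), e.apply_symm_apply c⟩]
    simp
  have hkeys : ∀ ω ω' : Sample F (Usr U V),
      restr keyVar Finset.univ ω = restr keyVar Finset.univ ω' ↔ ω.2 = ω'.2 := by
    intro ω ω'
    rw [restr_eq_iff, Subtype.ext_iff, funext_iff]
    simp [keyVar, funext_iff]
  have hinputs : ∀ ω ω' : Sample F (Usr U V),
      restr inputVar Finset.univ ω = restr inputVar Finset.univ ω' ↔ ω.1 = ω'.1 := by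
    intro ω ω'
    rw [restr_eq_iff]
    simp [inputVar, funext_iff]
  have hY : ∀ u, IsLinearMap F fun ω : Sample F (Usr U V) => ∑ i ∈ Ksrv U V u, msgVar i ω :=
    fun u => .finsetSum isLinearMap_msgVar _
  refine ⟨le_rfl, fun _ => by unfold unif; positivity, by simp [unif, hN], hW, ?_, hZS,
    condEnt_eq_zero _ _ fun ω ω' h => (hkeys ω ω').mpr (e.injective h),
    fun i => condEnt_eq_zero _ _ fun ω ω' h => ?_, fun u => condEnt_eq_zero _ _ fun ω ω' h => ?_,
    fun k => condEnt_eq_zero _ _ fun ω ω' h => ?_, fun k m n => ?_⟩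
  · rw [ent_congr _ _ (Y := fun ω => e ω.2) fun ω ω' => (hkeys ω ω').trans e.injective.eq_iff.symm,
      hZS, ent_unif_eq_finrank (F := F) ⊥ fun ω ω' => ?_]
    · simp only [hW]
      simp [Module.finrank_prod, finrank_zeroSum, ← card_usr]
      ring
    · rw [Prod.mk.injEq, hkeys, hinputs, Submodule.mem_bot, sub_eq_zero, Prod.ext_iff]
  · obtain ⟨h₁, h₂⟩ := Prod.mk.inj h
    simp only [msgVar, h₁, h₂]
  · exact Finset.sum_congr rfl ((restr_eq_iff _ _ _ _).mp h)
  · obtain ⟨h₁, h₂⟩ := Prod.mk.inj h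
    rw [restr_eq_iff] at h₁ h₂
    rw [← sum_msgVar, ← sum_msgVar, ← sum_servers, ← sum_servers]
    refine Finset.sum_congr rfl fun u _ => ?_
    by_cases hu : u = k
    · exact hu ▸ Finset.sum_congr rfl h₂
    · exact h₁ u (Finset.mem_erase.mpr ⟨hu, Finset.mem_univ u⟩)
  · refine mutInfo_unif_eq_zero
      ((isLinearMap_restr hY _).prodMk (isLinearMap_restr isLinearMap_msgVar _))
      (isLinearMap_restr isLinearMap_inputVar _)
      ((IsLinearMap.finsetSum isLinearMap_inputVar _).prodMk
        ((isLinearMap_restr isLinearMap_inputVar _).prodMk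
          (isLinearMap_restr isLinearMap_keyVar _))) fun ω hω => ?_
    obtain ⟨h₁, h₂⟩ := Prod.mk.inj hω
    obtain ⟨h₃, h₄⟩ := Prod.mk.inj h₂
    obtain ⟨a, b, hab, ha, hb, hsa, hWa, hZa, hZb⟩ := exists_split_sample (T n) ω h₁
      (fun i hi => congrFun h₃ ⟨i, hi⟩) (fun i hi => congrFun h₄ ⟨i, hi⟩)
    refine ⟨a, b, hab, ?_, ?_, ?_, ?_⟩
    · exact Prod.ext (funext fun u => Finset.sum_eq_zero fun i _ => ha i) (funext fun i => ha i.1)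
    · exact Prod.ext hsa
        (Prod.ext (funext fun i => hWa i.1 i.2) (funext fun i => hZa i.1 i.2))
    · exact funext fun i => hb i.1
    · exact Prod.ext (Finset.sum_eq_zero fun i _ => hb i)
        (Prod.ext (funext fun i => hb i.1) (funext fun i => hZb i.1 i.2))

theorem stmt17_achievability_eK
    (U : ℕ) (hU : 3 ≤ U) (V : Fin U → ℕ) (hV : ∀ u, 1 ≤ V u)
    (M N : ℕ) (S : Fin M → Finset (Usr U V)) (T : Fin N → Finset (Usr U V))
    (hSmono : ∀ (m : Fin M) (A : Finset (Usr U V)), A ⊆ S m → ∃ m', S m' = A)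
    (hTmono : ∀ (n : Fin N) (A : Finset (Usr U V)), A ⊆ T n → ∃ n', T n' = A)
    (hSne : (Finset.univ.biUnion fun m => S m).Nonempty)
    (hTcard : ∀ n, (T n).card ≤ Ktot U V - 2)
    (he : eStar U V S T = Ktot U V) :
    ∃ (F : Type) (iF : Field F) (iFt : Fintype F) (Ω : Type) (iΩ : Fintype Ω)
      (μ : Ω → ℝ) (L LZ : ℕ)
      (W : Usr U V → Ω → Fin L → F) (Z : Usr U V → Ω → Fin LZ → F)
      (X : Usr U V → Ω → Fin L → F) (Y : Fin U → Ω → Fin L → F)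
      (ZS : Ω → Fin ((Ktot U V - 1) * L) → F),
      @IsScheme U V M N S T F iF iFt Ω iΩ μ L L L LZ ((Ktot U V - 1) * L) W Z X Y ZS := by
  have : Nonempty (Usr U V) := let ⟨i, _⟩ := hSne; ⟨i⟩
  have hfin : Module.finrank (ZMod 2) (ZeroSum (ZMod 2) (Usr U V)) =
      Module.finrank (ZMod 2) (Fin ((Ktot U V - 1) * 1) → ZMod 2) := by
    rw [finrank_zeroSum, card_usr, Module.finrank_fin_fun, mul_one]
  exact ⟨ZMod 2, _, _, Sample (ZMod 2) (Usr U V), _,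
    unif _, 1, 1, inputVar, keyVar, msgVar, fun u ω => ∑ i ∈ Ksrv U V u, msgVar i ω,
    fun ω => LinearEquiv.ofFinrankEq _ _ hfin ω.2, isScheme_zeroSum U V S T (ZMod 2) _⟩
end

section
/- Fix a distinguished user (u₀,v₀) ∈ 𝒦, let {N_{u,v}}_{(u,v)∈𝒦∖{(u₀,v₀)}} be K−1 i.i.d. random vectors, each uniform on 𝔽_q^L, and define keys Z_{u,v} = N_{u,v} for (u,v) ≠ (u₀,v₀) and Z_{u₀,v₀} = −Σ_{(u,v)≠(u₀,v₀)} N_{u,v} (so the keys sum to zero). Let k ∈ [U], m ∈ [M], n ∈ [N] satisfy 𝒮_m ∩ 𝒯_n = ∅, |(𝒮_m ∩ 𝒦_{{k}}) ∪ 𝒦_{𝒰^{(m,n)}} ∪ 𝒯_n| ≤ K−1, and |(𝒮_m ∩ 𝒦_{{k}}) ∪ 𝒯_n| + |𝒰^{(m,n)} ∖ {k}| ≤ K−1. Then H({Σ_{v∈[V_u]} Z_{u,v}}_{u∈𝒰^{(m,n)}∖{k}}, {Z_{u,v}}_{(u,v)∈(𝒮_m∩𝒦_{{k}})∖𝒯_n}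 | {Z_{u,v}}_{(u,v)∈𝒯_n}) = (|𝒰^{(m,n)} ∖ {k}| + |(𝒮_m ∩ 𝒦_{{k}}) ∖ 𝒯_n|)·L, where entropies are in q-ary units. -/
open Finset

open scoped Classical

theorem sum_prb {Ω α : Type} [Fintype Ω] [Fintype α] (μ : Ω → ℝ) (X : Ω → α) :
    ∑ s, prb μ X s = ∑ ω, μ ω := by
  unfold prb
  exact Finset.sum_fiberwise _ _ _

theorem prb_nonneg {Ω α : Type} [Fintype Ω] {μ : Ω → ℝ} (hμ0 : ∀ ω, 0 ≤ μ ω) (X : Ω → α)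
    (s : α) : 0 ≤ prb μ X s :=
  Finset.sum_nonneg fun ω _ => hμ0 ω

theorem prb_comp {Ω α β : Type} [Fintype Ω] [Fintype α] (μ : Ω → ℝ) (X : Ω → α) (f : α → β)
    (b : β) : prb μ (fun ω => f (X ω)) b = ∑ a with f a = b, prb μ X a := by
  unfold prb
  rw [← Finset.sum_fiberwise_of_maps_to (s := Finset.univ.filter fun ω => f (X ω) = b)
    (t := Finset.univ.filter fun a => f a = b) (g := X) (by simp)]
  refine Finset.sum_congr rfl fun a ha => Finset.sum_congr ?_ fun _ _ => rfl
  ext ω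
  simp only [Finset.mem_filter, Finset.mem_univ, true_and] at ha ⊢
  exact ⟨fun h => h.2, fun h => ⟨h ▸ ha, h⟩⟩

theorem ent_eq_sum_negMulLog {Ω α : Type} [Fintype Ω] [Fintype α] (q : ℕ) (μ : Ω → ℝ)
    (X : Ω → α) : ent q μ X = (∑ s, Real.negMulLog (prb μ X s)) / Real.log q := by
  simp only [ent, Real.negMulLog, Real.logb, Finset.sum_div, ← Finset.sum_neg_distrib]
  exact Finset.sum_congr rfl fun s _ => by ring

/-- A random variable of maximal entropy is uniformly distributed. -/
theorem prb_eq_of_ent_eq {Ω α : Type} [Fintype Ω] [Fintype α] {q : ℕ} (hq : 1 < q) {μ : Ω → ℝ}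
    (hμ0 : ∀ ω, 0 ≤ μ ω) (hμ1 : ∑ ω, μ ω = 1) {X : Ω → α}
    (hX : ent q μ X = Real.logb q (Fintype.card α)) (s : α) :
    prb μ X s = (Fintype.card α : ℝ)⁻¹ := by
  have hn : (0 : ℝ) < Fintype.card α := by exact_mod_cast Fintype.card_pos_iff.2 ⟨s⟩
  have hlog : Real.log q ≠ 0 := (Real.log_pos (by exact_mod_cast hq)).ne'
  rw [ent_eq_sum_negMulLog, Real.logb, div_left_inj' hlog] at hX
  have hmean : ∑ a, (Fintype.card α : ℝ)⁻¹ • prb μ X a = (Fintype.card α : ℝ)⁻¹ := by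
    rw [← Finset.smul_sum, sum_prb, hμ1, smul_eq_mul, mul_one]
  have key := (Real.strictConcaveOn_negMulLog.map_sum_eq_iff (t := Finset.univ)
    (w := fun _ : α => (Fintype.card α : ℝ)⁻¹) (p := prb μ X) (fun _ _ => inv_pos.2 hn)
    (by simp [hn.ne']) (fun a _ => prb_nonneg hμ0 X a)).1 (by
      rw [hmean, ← Finset.smul_sum, hX, Real.negMulLog, Real.log_inv, smul_eq_mul]
      ring)
  rw [key s (Finset.mem_univ s), hmean]

theorem ent_of_uniform {Ω α : Type} [Fintype Ω] [Fintype α] [Nonempty α] (q : ℕ) {μ : Ω → ℝ}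
    {X : Ω → α} (hX : ∀ s, prb μ X s = (Fintype.card α : ℝ)⁻¹) :
    ent q μ X = Real.logb q (Fintype.card α) := by
  have hn : (Fintype.card α : ℝ) ≠ 0 := by exact_mod_cast Fintype.card_ne_zero
  simp only [ent, hX, Finset.sum_const, Finset.card_univ, nsmul_eq_mul, Real.logb_inv]
  field_simp

/-- The image of a uniform random variable under a surjective additive map is uniform. -/
theorem prb_comp_of_surjective {Ω α β : Type} [Fintype Ω] [Fintype α] [Fintype β] [AddGroup α]
    [AddGroup β] {μ : Ω → ℝ} {X : Ω → α} (hX : ∀ s, prb μ X s = (Fintype.card α : ℝ)⁻¹)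
    (f : α → β) (hadd : ∀ x y, f (x + y) = f x + f y) (hf : Function.Surjective f) (b : β) :
    prb μ (fun ω => f (X ω)) b = (Fintype.card β : ℝ)⁻¹ := by
  have hfib (c : β) : #{a | f a = c} = #{a | f a = b} :=
    AddMonoidHom.card_fiber_eq_of_mem_range (AddMonoidHom.mk' f hadd) (hf c) (hf b)
  have hcard : Fintype.card α = Fintype.card β * #{a | f a = b} := by
    rw [← Finset.card_univ (α := α), Finset.card_eq_sum_card_fiberwise (f := f)
      (t := Finset.univ) (by simp)]
    simp [hfib]
  have hα : (Fintype.card α : ℝ) ≠ 0 := by exact_mod_cast Fintype.card_ne_zero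
  have hβ : (Fintype.card β : ℝ) ≠ 0 := by exact_mod_cast Fintype.card_ne_zero
  rw [prb_comp]
  simp only [hX, Finset.sum_const, nsmul_eq_mul]
  rw [← div_eq_mul_inv, div_eq_iff hα, hcard]
  push_cast
  field_simp

theorem ent_comp_of_surjective {Ω α β : Type} [Fintype Ω] [Fintype α] [Fintype β] [AddGroup α]
    [AddGroup β] (q : ℕ) {μ : Ω → ℝ} {X : Ω → α}
    (hX : ∀ s, prb μ X s = (Fintype.card α : ℝ)⁻¹)
    (f : α → β) (hadd : ∀ x y, f (x + y) = f x + f y) (hf : Function.Surjective f) :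
    ent q μ (fun ω => f (X ω)) = Real.logb q (Fintype.card β) :=
  ent_of_uniform q (prb_comp_of_surjective hX f hadd hf)

theorem logb_card_fun {ι F : Type} [Fintype ι] [Fintype F] (L : ℕ) [Fintype (ι → Fin L → F)]
    (hF : 1 < Fintype.card F) :
    Real.logb (Fintype.card F) (Fintype.card (ι → Fin L → F)) = (Fintype.card ι : ℝ) * L := by
  have h : Fintype.card (ι → Fin L → F) = Fintype.card F ^ (L * Fintype.card ι) := by
    rw [Fintype.card_eq_nat_card, Nat.card_fun, Nat.card_fun]
    simp [pow_mul]
  have hF' : (1 : ℝ) < Fintype.card F := by exact_mod_cast hF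
  rw [h, Nat.cast_pow, Real.logb_pow, Real.logb_self_eq_one hF']
  push_cast
  ring

/-- Extend a family indexed by all indices but `i0` to a family with sum zero. -/
def zeroSumExtend {ι G : Type} [Fintype ι] [DecidableEq ι] [AddCommGroup G] (i0 : ι)
    (n : { i // i ∈ Finset.univ.erase i0 } → G) (i : ι) : G :=
  if h : i ∈ Finset.univ.erase i0 then n ⟨i, h⟩ else -∑ j, n j

theorem zeroSumExtend_add {ι G : Type} [Fintype ι] [DecidableEq ι] [AddCommGroup G] (i0 : ι)
    (x y : { i // i ∈ Finset.univ.erase i0 } → G) :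
    zeroSumExtend i0 (x + y) = zeroSumExtend i0 x + zeroSumExtend i0 y := by
  funext i
  by_cases h : i ∈ Finset.univ.erase i0
  · simp only [zeroSumExtend, dif_pos h, Pi.add_apply]
  · simp only [zeroSumExtend, dif_neg h, Pi.add_apply, Finset.sum_add_distrib, neg_add]

theorem zeroSumExtend_restrict {ι G : Type} [Fintype ι] [DecidableEq ι] [AddCommGroup G] (i0 : ι)
    {z : ι → G} (hz : ∑ i, z i = 0) :
    zeroSumExtend i0 (fun j => z j.1) = z := by
  funext i
  by_cases h : i ∈ Finset.univ.erase i0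
  · simp only [zeroSumExtend, dif_pos h]
  · obtain rfl : i = i0 := by simpa using h
    simp only [zeroSumExtend, dif_neg h]
    rw [Finset.sum_coe_sort (Finset.univ.erase i) z, neg_eq_iff_add_eq_zero, add_comm,
      Finset.add_sum_erase _ _ (Finset.mem_univ i), hz]

/-- A zero-sum family can be prescribed on `D` and `T`, together with its sums over the
servers in `A`, as soon as each server in `A` has a user outside `T` and some user lies
outside all the sets involved. -/
theorem exists_zeroSum_family {U : ℕ} {V : Fin U → ℕ} {G : Type} [AddCommGroup G]
    {A : Finset (Fin U)} {D T : Finset (Usr U V)} (hDT : Disjoint D T)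
    (hDA : ∀ i ∈ D, i.1 ∉ A) {p : Fin U → Usr U V} (hp : ∀ u ∈ A, (p u).1 = u ∧ p u ∉ T)
    {j : Usr U V} (hjA : j.1 ∉ A) (hjD : j ∉ D) (hjT : j ∉ T)
    (a : { u // u ∈ A } → G) (d : { i // i ∈ D } → G) (t : { i // i ∈ T } → G) :
    ∃ z : Usr U V → G, ∑ i, z i = 0 ∧ (∀ u : { u // u ∈ A }, ∑ v, z ⟨u.1, v⟩ = a u) ∧
      (∀ i : { i // i ∈ D }, z i.1 = d i) ∧ ∀ i : { i // i ∈ T }, z i.1 = t i := by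
  let y : Usr U V → G := fun i => if h : i ∈ T then t ⟨i, h⟩ else if h : i ∈ D then d ⟨i, h⟩ else 0
  let c : Fin U → G := fun u => if h : u ∈ A then a ⟨u, h⟩ - ∑ v, y ⟨u, v⟩ else 0
  let w : Usr U V → G := fun i => y i + if i = p i.1 then c i.1 else 0
  refine ⟨fun i => w i - if i = j then ∑ i, w i else 0, ?_, ?_, ?_, ?_⟩
  · simp [Finset.sum_sub_distrib]
  · rintro ⟨u, hu⟩
    have hne (v : Fin (V u)) : (⟨u, v⟩ : Usr U V) ≠ j := by
      rintro rfl
      exact hjA hu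
    obtain ⟨v0, hv0⟩ : ∃ v0 : Fin (V u), p u = ⟨u, v0⟩ := by
      have h := (hp u hu).1
      generalize p u = x at h
      obtain ⟨x1, x2⟩ := x
      subst h
      exact ⟨x2, rfl⟩
    simp only [hne, if_false, sub_zero, w, Finset.sum_add_distrib, hv0, Sigma.mk.injEq, heq_eq_eq,
      true_and, Finset.sum_ite_eq', Finset.mem_univ, if_true, c, dif_pos hu]
    abel
  · rintro ⟨i, hi⟩
    have hij : i ≠ j := by
      rintro rfl
      exact hjD hi
    have hiT : i ∉ T := Finset.disjoint_left.1 hDT hi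
    simp [w, y, c, hij, hi, hiT, hDA i hi]
  · rintro ⟨i, hi⟩
    have hij : i ≠ j := by
      rintro rfl
      exact hjT hi
    have hc : (if i = p i.1 then c i.1 else 0) = 0 := by
      by_cases hA : i.1 ∈ A
      · rw [if_neg]
        intro h
        exact (hp _ hA).2 (h ▸ hi)
      · simp [c, hA]
    simp [w, y, hij, hi, hc]

theorem stmt18_key_entropy_computation
    (U : ℕ) (hU : 3 ≤ U) (V : Fin U → ℕ) (hV : ∀ u, 1 ≤ V u)
    (Sm Tn : Finset (Usr U V)) (k : Fin U)
    (hdisj : Sm ∩ Tn = ∅)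
    (hB : (BigB U V Sm Tn k).card ≤ Ktot U V - 1)
    (hE : ((Sm ∩ Ksrv U V k) ∪ Tn).card + ((UServers U V Sm Tn).erase k).card ≤ Ktot U V - 1)
    (F : Type) [Field F] [Fintype F] (Ω : Type) [Fintype Ω] (μ : Ω → ℝ)
    (hμ0 : ∀ ω, 0 ≤ μ ω) (hμ1 : ∑ ω, μ ω = 1)
    (L : ℕ) (i0 : Usr U V)
    (Nv : Usr U V → Ω → Fin L → F)
    (hN : ent (Fintype.card F) μ (restr Nv (Finset.univ.erase i0)) = ((Ktot U V - 1 : ℕ) : ℝ) * L)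
    (Z : Usr U V → Ω → Fin L → F)
    (hZ1 : ∀ i, i ≠ i0 → Z i = Nv i)
    (hZ2 : Z i0 = fun ω => -∑ j ∈ Finset.univ.erase i0, Nv j ω) :
    condEnt (Fintype.card F) μ
      (fun ω => ((fun u : { x // x ∈ (UServers U V Sm Tn).erase k } =>
          ∑ v : Fin (V u.1), Z ⟨u.1, v⟩ ω),
        restr Z ((Sm ∩ Ksrv U V k) \ Tn) ω))
      (restr Z Tn) =
    ((((UServers U V Sm Tn).erase k).card : ℝ) + (((Sm ∩ Ksrv U V k) \ Tn).card : ℝ)) * L := by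
  have hF : 1 < Fintype.card F := Fintype.one_lt_card
  set A := (UServers U V Sm Tn).erase k with hA
  set D := (Sm ∩ Ksrv U V k) \ Tn
  have hunif := prb_eq_of_ent_eq hF hμ0 hμ1 (X := restr Nv (Finset.univ.erase i0)) (by
    rw [hN, logb_card_fun L hF]
    rw [Fintype.card_coe, Finset.card_erase_of_mem (Finset.mem_univ _), Finset.card_univ, card_usr])
  have hZ (i : Usr U V) (ω : Ω) :
      Z i ω = zeroSumExtend i0 (restr Nv (Finset.univ.erase i0) ω) i := by
    by_cases h : i ∈ Finset.univ.erase i0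
    · simp only [zeroSumExtend, dif_pos h, restr, hZ1 i (Finset.ne_of_mem_erase h)]
    · obtain rfl : i = i0 := by simpa using h
      simp only [zeroSumExtend, dif_neg h, restr, hZ2]
      rw [Finset.sum_coe_sort (Finset.univ.erase i) fun j => Nv j ω]
  have hdisj' := Finset.disjoint_iff_inter_eq_empty.2 hdisj
  have hp : ∀ u : Fin U, ∃ i : Usr U V, u ∈ A → i.1 = u ∧ i ∉ Tn := by
    intro u
    by_cases hu : u ∈ A
    · obtain ⟨i, hi⟩ := (Finset.mem_filter.1 (Finset.mem_of_mem_erase hu)).2.1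
      obtain ⟨hiS, hiK⟩ := Finset.mem_inter.1 hi
      exact ⟨i, fun _ => ⟨(Finset.mem_filter.1 hiK).2, Finset.disjoint_left.1 hdisj' hiS⟩⟩
    · exact ⟨i0, fun h => absurd h hu⟩
  choose p hp using hp
  obtain ⟨j, hj⟩ : ∃ j, j ∉ BigB U V Sm Tn k := by
    by_contra! h
    rw [Finset.eq_univ_iff_forall.2 h, Finset.card_univ, card_usr] at hB
    have hpos : 0 < Ktot U V := card_usr U V ▸ Fintype.card_pos_iff.2 ⟨i0⟩
    omega
  simp only [BigB, Finset.mem_union, not_or, KsrvSet, Finset.mem_filter, Finset.mem_univ,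
    true_and] at hj
  have hDA : ∀ i ∈ D, i.1 ∉ A := by
    intro i hi
    have hik : i.1 = k :=
      (Finset.mem_filter.1 (Finset.mem_inter.1 (Finset.mem_sdiff.1 hi).1).2).2
    simp [hA, hik]
  let f : ({ i // i ∈ Finset.univ.erase i0 } → Fin L → F) →
      (({ u // u ∈ A } → Fin L → F) × ({ i // i ∈ D } → Fin L → F)) ×
        ({ i // i ∈ Tn } → Fin L → F) := fun n =>
    ((fun u => ∑ v, zeroSumExtend i0 n ⟨u.1, v⟩, fun i => zeroSumExtend i0 n i.1),
      fun i => zeroSumExtend i0 n i.1)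
  have hadd (x y) : f (x + y) = f x + f y := by
    simp only [f, zeroSumExtend_add, Pi.add_apply, Finset.sum_add_distrib]
    rfl
  have hsurj : Function.Surjective f := by
    rintro ⟨⟨a, d⟩, t⟩
    obtain ⟨z, h0, ha, hd, ht⟩ := exists_zeroSum_family Finset.sdiff_disjoint hDA hp
      (fun h => hj.1.2 (Finset.mem_of_mem_erase h)) (fun h => hj.1.1 (Finset.mem_sdiff.1 h).1)
      hj.2 a d t
    refine ⟨fun i => z i.1, ?_⟩
    simp only [f, zeroSumExtend_restrict i0 h0, ha, hd, ht]
  have hjoint := ent_comp_of_surjective (Fintype.card F) hunif f hadd hsurj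
  have hcond := ent_comp_of_surjective (Fintype.card F) hunif (fun n => (f n).2)
    (fun x y => by rw [hadd]; rfl) (Prod.snd_surjective.comp hsurj)
  have hne {ι : Type} [Fintype (ι → Fin L → F)] : (Fintype.card (ι → Fin L → F) : ℝ) ≠ 0 := by
    exact_mod_cast Fintype.card_ne_zero
  simp only [Fintype.card_prod, Nat.cast_mul] at hjoint
  rw [Real.logb_mul (mul_ne_zero hne hne) hne, Real.logb_mul hne hne] at hjoint
  simp only [logb_card_fun L hF, Fintype.card_coe] at hjoint hcond
  have hrestr (B : Finset (Usr U V)) : restr Z B = fun ω i =>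
      zeroSumExtend i0 (restr Nv (Finset.univ.erase i0) ω) i.1 := by
    funext ω i
    exact hZ i.1 ω
  have hX : (fun ω => ((fun u : { x // x ∈ A } => ∑ v : Fin (V u.1), Z ⟨u.1, v⟩ ω,
      restr Z D ω), restr Z Tn ω)) = fun ω => f (restr Nv (Finset.univ.erase i0) ω) := by
    simp only [f, hrestr, hZ]
  have hY : restr Z Tn = fun ω => (f (restr Nv (Finset.univ.erase i0) ω)).2 :=
    hrestr Tn
  rw [condEnt, hX, hY, hjoint, hcond]
  ring
end
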